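/- Let ε ∈ (0, 1), let π* = ε^{ε/(1-ε)} / (1 + (1-ε)·ε^{ε/(1-ε)}), and let b ∈ [(1-ε)π*, 1-ε]. Then the supremum of f(π) = H₂(π(1-ε)) − π·H₂(ε) over all π ∈ [0,1] satisfying π(1-ε) ≥ b equals H₂(b) − (b/(1-ε))·H₂(ε), and it is attained at π = b/(1-ε). (This is the information-energy capacity function C(b) of the Z-channel in the energy-constrained regime.) -/

import Mathlib

/-- The binary entropy function `H₂(x) = -x·log₂ x - (1-x)·log₂(1-x)`,
with the convention `0·log₂ 0 = 0` (automatic since `Real.logb 2 0 = 0`). -/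
noncomputable def binEnt (x : ℝ) : ℝ :=
  -x * Real.logb 2 x - (1 - x) * Real.logb 2 (1 - x)

open Real in
lemma binEnt_eq_binEntropy_div_log_two (x : ℝ) : binEnt x = binEntropy x / log 2 := by
  simp only [binEnt, binEntropy, logb, log_inv]
  ring

/-- A tilted binary entropy is antitone to the right of its critical point `r / (1 + r)`. -/
lemma antitoneOn_binEntropy_add_mul_log {r : ℝ} (hr : 0 < r) :
    AntitoneOn (fun x => Real.binEntropy x + x * Real.log r) (Set.Icc (r / (1 + r)) 1) := by
  have hr1 : 0 < 1 + r := by linarith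
  have hr0 : 0 < r / (1 + r) := by positivity
  have hderiv : ∀ x ∈ interior (Set.Icc (r / (1 + r)) 1),
      HasDerivAt (fun x => Real.binEntropy x + x * Real.log r)
        (Real.log (1 - x) - Real.log x + 1 * Real.log r) x := by
    intro x hx
    rw [interior_Icc] at hx
    exact (Real.hasDerivAt_binEntropy (hr0.trans hx.1).ne' hx.2.ne).add
      ((hasDerivAt_id x).mul_const _)
  refine antitoneOn_of_deriv_nonpos (convex_Icc _ _) (by fun_prop)
    (fun x hx => (hderiv x hx).differentiableAt.differentiableWithinAt) fun x hx => ?_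
  rw [(hderiv x hx).deriv]
  rw [interior_Icc] at hx
  have hx1 : 0 < 1 - x := by linarith [hx.2]
  have hrx : r ≤ x * (1 + r) := ((div_lt_iff₀ hr1).mp hx.1).le
  have hlog : Real.log ((1 - x) * r) ≤ Real.log x :=
    Real.log_le_log (by positivity) (by linarith)
  rw [Real.log_mul hx1.ne' hr.ne'] at hlog
  linarith

lemma binEntropy_eq_neg_mul_log {ε : ℝ} (hε : ε ∈ Set.Ioo (0 : ℝ) 1) :
    Real.binEntropy ε = -((1 - ε) * Real.log ((1 - ε) * ε ^ (ε / (1 - ε)))) := by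
  have h1 : 0 < 1 - ε := by linarith [hε.2]
  rw [Real.log_mul h1.ne' (Real.rpow_pos_of_pos hε.1 _).ne', Real.log_rpow hε.1]
  simp only [Real.binEntropy, Real.log_inv]
  field_simp
  ring

/-- For `ε ∈ (0,1)`, `π* = ε^{ε/(1-ε)}/(1 + (1-ε)·ε^{ε/(1-ε)})` and `b ∈ [(1-ε)π*, 1-ε]`,
the supremum of the Z-channel mutual information `f(π) = H₂(π(1-ε)) - π·H₂(ε)` over all
`π ∈ [0,1]` with energy rate `π(1-ε) ≥ b` equals `H₂(b) - (b/(1-ε))·H₂(ε)`, and it is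
attained at `π = b/(1-ε)` (information-energy capacity function of the Z-channel in the
energy-constrained regime). -/
theorem z_channel_capacity_constrained (ε b : ℝ) (hε : ε ∈ Set.Ioo (0 : ℝ) 1)
    (hb : b ∈ Set.Icc
      ((1 - ε) * (ε ^ (ε / (1 - ε)) / (1 + (1 - ε) * ε ^ (ε / (1 - ε))))) (1 - ε)) :
    IsGreatest {y : ℝ | ∃ π ∈ Set.Icc (0 : ℝ) 1,
        b ≤ π * (1 - ε) ∧ y = binEnt (π * (1 - ε)) - π * binEnt ε}
      (binEnt b - (b / (1 - ε)) * binEnt ε) ∧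
    b / (1 - ε) ∈ Set.Icc (0 : ℝ) 1 ∧
    b ≤ (b / (1 - ε)) * (1 - ε) ∧
    binEnt ((b / (1 - ε)) * (1 - ε)) - (b / (1 - ε)) * binEnt ε =
      binEnt b - (b / (1 - ε)) * binEnt ε := by
  have h1 : 0 < 1 - ε := by linarith [hε.2]
  have hA : 0 < ε ^ (ε / (1 - ε)) := Real.rpow_pos_of_pos hε.1 _
  obtain ⟨hb0, hb1⟩ := hb
  have hcancel : b / (1 - ε) * (1 - ε) = b := div_mul_cancel₀ _ h1.ne'
  have hmem : b / (1 - ε) ∈ Set.Icc (0 : ℝ) 1 :=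
    ⟨div_nonneg (le_trans (by positivity) hb0) h1.le, (div_le_one h1).mpr hb1⟩
  refine ⟨⟨⟨b / (1 - ε), hmem, hcancel.ge, by rw [hcancel]⟩, ?_⟩, hmem, hcancel.ge,
    by rw [hcancel]⟩
  rintro y ⟨p, hp, hbp, rfl⟩
  have hp1 : p * (1 - ε) ≤ 1 := by nlinarith [hp.2, hε.1]
  rw [← mul_div_assoc] at hb0
  have hanti := antitoneOn_binEntropy_add_mul_log (mul_pos h1 hA)
    ⟨hb0, hbp.trans hp1⟩ ⟨hb0.trans hbp, hp1⟩ hbp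
  have hvalue : ∀ q : ℝ, binEnt (q * (1 - ε)) - q * binEnt ε =
      (Real.binEntropy (q * (1 - ε)) +
        q * (1 - ε) * Real.log ((1 - ε) * ε ^ (ε / (1 - ε)))) / Real.log 2 := by
    intro q
    rw [binEnt_eq_binEntropy_div_log_two, binEnt_eq_binEntropy_div_log_two,
      binEntropy_eq_neg_mul_log hε]
    ring
  have hvalue_b := hvalue (b / (1 - ε))
  rw [hcancel] at hvalue_b
  rw [hvalue p, hvalue_b]
  exact div_le_div_of_nonneg_right hanti (Real.log_pos one_lt_two).le
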